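/- Let (X,H,ν) be a categorical augmented rack with H cocommutative and X cocommutative, and let R : X⊗X → X⊗X be the R-matrix R(x⊗y) = y⁽¹⁾ ⊗ (x·ν(y⁽²⁾)). Define R' : X⊗X → X⊗X by R'(x⊗y) = ( y·S(ν(x⁽²⁾)) ) ⊗ x⁽¹⁾. Then R'∘R = id_{X⊗X} and R∘R' = id_{X⊗X}; in particular R is invertible. -/

import Mathlib

open TensorProduct

variable {k : Type*} [CommRing k] {H : Type*} [Ring H] [HopfAlgebra k H]
variable {X : Type*} [AddCommGroup X] [Module k X] [Coalgebra k X]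

/-- `sandwich a` is the linear map `H ⊗ H → H` sending `g⁽¹⁾ ⊗ g⁽²⁾` to `S(g⁽¹⁾) * a * g⁽²⁾`. -/
noncomputable def sandwich (a : H) : H ⊗[k] H →ₗ[k] H :=
  LinearMap.mul' k H ∘ₗ
    LinearMap.rTensor H (LinearMap.mulRight k a ∘ₗ HopfAlgebra.antipode (R := k))

/-- `Δ` followed by the flip and by a map which is convolution-trivial on `Δ` collapses the last two
legs of the iterated comultiplication. -/
theorem lTensor_comm_assoc_rTensor_comul {Y : Type*} [AddCommGroup Y] [Module k Y]
    (hcocomm : ∀ x : X, (TensorProduct.comm k X X) (Coalgebra.comul (R := k) x) =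
      Coalgebra.comul (R := k) x)
    (f : X ⊗[k] X →ₗ[k] Y) (y : Y)
    (hf : ∀ x : X, f (Coalgebra.comul (R := k) x) = Coalgebra.counit (R := k) x • y) (x : X) :
    LinearMap.lTensor X (f ∘ₗ (TensorProduct.comm k X X).toLinearMap)
      (TensorProduct.assoc k X X X
        (LinearMap.rTensor X (Coalgebra.comul (R := k)) (Coalgebra.comul (R := k) x))) =
      x ⊗ₜ y := by
  have hcomp : (f ∘ₗ (TensorProduct.comm k X X).toLinearMap) ∘ₗ Coalgebra.comul (R := k) =
      LinearMap.toSpanSingleton k Y y ∘ₗ Coalgebra.counit (R := k) := by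
    ext z
    simp [hcocomm, hf]
  rw [Coalgebra.coassoc_apply, ← LinearMap.lTensor_comp_apply, hcomp,
    LinearMap.lTensor_comp_apply, Coalgebra.lTensor_counit_comul]
  simp

/-- A comultiplicative, counital map `ν` is convolution-inverse to `S ∘ ν` on the left. -/
theorem mul_map_antipode_comp_comul (ν : X →ₗ[k] H)
    (hν_comul : (Coalgebra.comul (R := k) (A := H)) ∘ₗ ν =
      TensorProduct.map ν ν ∘ₗ Coalgebra.comul (R := k))
    (hν_counit : (Coalgebra.counit (R := k) (A := H)) ∘ₗ ν = Coalgebra.counit (R := k)) (x : X) :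
    LinearMap.mul' k H (TensorProduct.map (HopfAlgebra.antipode (R := k) ∘ₗ ν) ν
      (Coalgebra.comul (R := k) x)) = Coalgebra.counit (R := k) x • (1 : H) := by
  have h := HopfAlgebra.mul_antipode_rTensor_comul_apply (R := k) (ν x)
  rw [← LinearMap.comp_apply (Coalgebra.comul (R := k)) ν, hν_comul, LinearMap.comp_apply,
    ← LinearMap.comp_apply (LinearMap.rTensor _ _), LinearMap.rTensor_comp_map,
    ← LinearMap.comp_apply (Coalgebra.counit (R := k)) ν, hν_counit] at h
  rw [h, Algebra.algebraMap_eq_smul_one]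

/-- A comultiplicative, counital map `ν` is convolution-inverse to `S ∘ ν` on the right. -/
theorem mul_map_comp_antipode_comul (ν : X →ₗ[k] H)
    (hν_comul : (Coalgebra.comul (R := k) (A := H)) ∘ₗ ν =
      TensorProduct.map ν ν ∘ₗ Coalgebra.comul (R := k))
    (hν_counit : (Coalgebra.counit (R := k) (A := H)) ∘ₗ ν = Coalgebra.counit (R := k)) (x : X) :
    LinearMap.mul' k H (TensorProduct.map ν (HopfAlgebra.antipode (R := k) ∘ₗ ν)
      (Coalgebra.comul (R := k) x)) = Coalgebra.counit (R := k) x • (1 : H) := by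
  have h := HopfAlgebra.mul_antipode_lTensor_comul_apply (R := k) (ν x)
  rw [← LinearMap.comp_apply (Coalgebra.comul (R := k)) ν, hν_comul, LinearMap.comp_apply,
    ← LinearMap.comp_apply (LinearMap.lTensor _ _), LinearMap.lTensor_comp_map,
    ← LinearMap.comp_apply (Coalgebra.counit (R := k)) ν, hν_counit] at h
  rw [h, Algebra.algebraMap_eq_smul_one]

/-- for a categorical augmented rack `(X, H, ν)` with `H` and `X`
cocommutative, the R-matrix `R(x⊗y) = y⁽¹⁾ ⊗ (x·ν(y⁽²⁾))` is invertible, with inverse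
`R'(x⊗y) = (y·S(ν(x⁽²⁾))) ⊗ x⁽¹⁾`: both `R' ∘ R = id` and `R ∘ R' = id`. -/
theorem R_matrix_invertible
    (hcocommH : ∀ g : H, (TensorProduct.comm k H H) (Coalgebra.comul (R := k) g) =
      Coalgebra.comul (R := k) g)
    (hcocommX : ∀ x : X, (TensorProduct.comm k X X) (Coalgebra.comul (R := k) x) =
      Coalgebra.comul (R := k) x)
    (act : X ⊗[k] H →ₗ[k] X)
    (hact_one : ∀ x : X, act (x ⊗ₜ (1 : H)) = x)
    (hact_mul : ∀ (x : X) (g h : H), act (act (x ⊗ₜ g) ⊗ₜ h) = act (x ⊗ₜ (g * h)))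
    (hcompat : (Coalgebra.comul (R := k) (A := X)) ∘ₗ act =
      TensorProduct.map act act ∘ₗ (TensorProduct.tensorTensorTensorComm k X X H H).toLinearMap
        ∘ₗ TensorProduct.map (Coalgebra.comul (R := k)) (Coalgebra.comul (R := k)))
    (hcounit : ∀ (x : X) (g : H),
      Coalgebra.counit (R := k) (act (x ⊗ₜ g)) =
        Coalgebra.counit (R := k) x * Coalgebra.counit (R := k) g)
    (ν : X →ₗ[k] H)
    (hν_comul : (Coalgebra.comul (R := k) (A := H)) ∘ₗ ν =
      TensorProduct.map ν ν ∘ₗ Coalgebra.comul (R := k))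
    (hν_counit : (Coalgebra.counit (R := k) (A := H)) ∘ₗ ν = Coalgebra.counit (R := k))
    (hν_aug : ∀ (x : X) (g : H), ν (act (x ⊗ₜ g)) = sandwich (ν x) (Coalgebra.comul (R := k) g))
    -- the R-matrix `R(x ⊗ y) = y⁽¹⁾ ⊗ (x · ν(y⁽²⁾))`
    (R : X ⊗[k] X →ₗ[k] X ⊗[k] X)
    (hR : ∀ x y : X, R (x ⊗ₜ y) =
      LinearMap.lTensor X (act ∘ₗ LinearMap.lTensor X ν)
        ((TensorProduct.leftComm k X X X) (x ⊗ₜ Coalgebra.comul (R := k) y)))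
    -- the candidate inverse `R'(x ⊗ y) = (y · S(ν(x⁽²⁾))) ⊗ x⁽¹⁾`
    (R' : X ⊗[k] X →ₗ[k] X ⊗[k] X)
    (hR' : ∀ x y : X, R' (x ⊗ₜ y) =
      (TensorProduct.comm k X X)
        (LinearMap.lTensor X
            (act ∘ₗ
              TensorProduct.map LinearMap.id (HopfAlgebra.antipode (R := k) ∘ₗ ν) ∘ₗ
              (TensorProduct.comm k X X).toLinearMap)
          ((TensorProduct.assoc k X X X) (Coalgebra.comul (R := k) x ⊗ₜ y)))) :
    R' ∘ₗ R = LinearMap.id ∧ R ∘ₗ R' = LinearMap.id := by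
  constructor
  · refine TensorProduct.ext' fun x y => ?_
    let f : X ⊗[k] X →ₗ[k] X := act ∘ₗ TensorProduct.mk k X H x ∘ₗ LinearMap.mul' k H ∘ₗ
      TensorProduct.map ν (HopfAlgebra.antipode (R := k) ∘ₗ ν)
    have hf : ∀ z, f (Coalgebra.comul (R := k) z) = Coalgebra.counit (R := k) z • x := fun z => by
      simp only [f, LinearMap.comp_apply, mul_map_comp_antipode_comul ν hν_comul hν_counit,
        map_smul, TensorProduct.mk_apply, hact_one]
    have hR'f : ∀ t : X ⊗[k] X,
        R' (LinearMap.lTensor X (act ∘ₗ LinearMap.lTensor X ν)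
          (TensorProduct.leftComm k X X X (x ⊗ₜ t))) =
        TensorProduct.comm k X X
          (LinearMap.lTensor X (f ∘ₗ (TensorProduct.comm k X X).toLinearMap)
            (TensorProduct.assoc k X X X
              (LinearMap.rTensor X (Coalgebra.comul (R := k)) t))) := fun t => by
      induction t with
      | zero => simp
      | add t u ht hu => simp only [TensorProduct.tmul_add, map_add, ht, hu]
      | tmul a b =>
        simp only [TensorProduct.leftComm_tmul, LinearMap.lTensor_tmul, LinearMap.rTensor_tmul,
          LinearMap.comp_apply, hR']
        generalize Coalgebra.comul (R := k) a = w
        induction w with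
        | zero => simp
        | add t u ht hu => simp only [TensorProduct.add_tmul, map_add, ht, hu]
        | tmul c d => simp [f, hact_mul]
    rw [LinearMap.comp_apply, hR, hR'f, lTensor_comm_assoc_rTensor_comul hcocommX f x hf]
    simp
  · refine TensorProduct.ext' fun x y => ?_
    let f : X ⊗[k] X →ₗ[k] X := act ∘ₗ TensorProduct.mk k X H y ∘ₗ LinearMap.mul' k H ∘ₗ
      TensorProduct.map (HopfAlgebra.antipode (R := k) ∘ₗ ν) ν
    have hf : ∀ z, f (Coalgebra.comul (R := k) z) = Coalgebra.counit (R := k) z • y := fun z => by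
      simp only [f, LinearMap.comp_apply, mul_map_antipode_comp_comul ν hν_comul hν_counit,
        map_smul, TensorProduct.mk_apply, hact_one]
    have hRf : ∀ t : X ⊗[k] X,
        R (TensorProduct.comm k X X
          (LinearMap.lTensor X
              (act ∘ₗ
                TensorProduct.map LinearMap.id (HopfAlgebra.antipode (R := k) ∘ₗ ν) ∘ₗ
                (TensorProduct.comm k X X).toLinearMap)
            (TensorProduct.assoc k X X X (t ⊗ₜ y)))) =
        LinearMap.lTensor X (f ∘ₗ (TensorProduct.comm k X X).toLinearMap)
          (TensorProduct.assoc k X X X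
            (LinearMap.rTensor X (Coalgebra.comul (R := k)) t)) := fun t => by
      induction t with
      | zero => simp
      | add t u ht hu => simp only [TensorProduct.add_tmul, map_add, ht, hu]
      | tmul a b =>
        simp only [TensorProduct.assoc_tmul, LinearMap.lTensor_tmul, LinearMap.rTensor_tmul,
          TensorProduct.comm_tmul, hR]
        generalize Coalgebra.comul (R := k) a = w
        induction w with
        | zero => simp
        | add t u ht hu =>
          simp only [TensorProduct.add_tmul, TensorProduct.tmul_add, map_add, ht, hu]
        | tmul c d => simp [f, hact_mul]
    rw [LinearMap.comp_apply, hR', hRf, lTensor_comm_assoc_rTensor_comul hcocommX f y hf]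
    simp
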